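/- (Suboptimality of the misspecified-model controller under modeling error only at the first time step.) There is an absolute constant C > 0 with the following property. Suppose d ≤ n, σ̲(R) ≥ 1, Â_t = A_t and B̂_t = B_t for all t = 1,…,H−1, ‖A_0 − Â_0‖ ≤ ε_A and ‖B_0 − B̂_0‖ ≤ ε_B with 0 < ε_A, ε_B < Γ, ‖A_t + B_t K*_t‖ ≤ 1 − δ for some 0 < δ ≤ 1 and all t, and ‖K*_t − K^CE_t‖ ≤ δ/(2‖B_t‖) for all t. Then V^CE_0(x_0) − V*_0(x_0) ≤ C·d·Γ⁹·‖x_0‖²·(ε_A + ε_A² + ε_B + ε_B²)², where V^CE_0(x_0) is the closed-loop cost of the controller (K^CE_0,…,K^CE_{H−1}) on the true system. -/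

import Mathlib

open Matrix

/-- The operator norm of a real matrix induced by the Euclidean vector norm. -/
noncomputable def mnorm {m n : ℕ} (A : Matrix (Fin m) (Fin n) ℝ) : ℝ :=
  ‖LinearMap.toContinuousLinearMap (Matrix.toEuclideanLin A)‖

/-- The Euclidean norm of a real vector. -/
noncomputable def vnorm {n : ℕ} (x : Fin n → ℝ) : ℝ :=
  Real.sqrt (∑ i, x i ^ 2)

open scoped Matrix.Norms.L2Operator in
theorem mnorm_eq {m n : ℕ} (A : Matrix (Fin m) (Fin n) ℝ) : mnorm A = ‖A‖ := rfl

theorem mnorm_nn {m n : ℕ} (A : Matrix (Fin m) (Fin n) ℝ) : 0 ≤ mnorm A := norm_nonneg _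

open scoped Matrix.Norms.L2Operator in
theorem mnorm_mul_le {m n k : ℕ} (A : Matrix (Fin m) (Fin n) ℝ) (B : Matrix (Fin n) (Fin k) ℝ) :
    mnorm (A * B) ≤ mnorm A * mnorm B := Matrix.l2_opNorm_mul A B

open scoped Matrix.Norms.L2Operator in
theorem mnorm_add_le {m n : ℕ} (A B : Matrix (Fin m) (Fin n) ℝ) :
    mnorm (A + B) ≤ mnorm A + mnorm B := norm_add_le A B

open scoped Matrix.Norms.L2Operator in
theorem mnorm_neg' {m n : ℕ} (A : Matrix (Fin m) (Fin n) ℝ) :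
    mnorm (-A) = mnorm A := norm_neg A

open scoped Matrix.Norms.L2Operator in
theorem mnorm_tr {m n : ℕ} (A : Matrix (Fin m) (Fin n) ℝ) :
    mnorm Aᵀ = mnorm A := by
  have := Matrix.l2_opNorm_conjTranspose A
  rwa [Matrix.conjTranspose_eq_transpose_of_trivial] at this

theorem vnorm_eq {n : ℕ} (x : Fin n → ℝ) : vnorm x = ‖WithLp.toLp 2 x‖ := by
  simp [vnorm, EuclideanSpace.norm_eq]

theorem vnorm_nn {n : ℕ} (x : Fin n → ℝ) : 0 ≤ vnorm x := Real.sqrt_nonneg _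

theorem vnorm_sq {n : ℕ} (x : Fin n → ℝ) : vnorm x ^ 2 = x ⬝ᵥ x := by
  rw [vnorm, Real.sq_sqrt (Finset.sum_nonneg fun i _ => sq_nonneg _)]
  simp [dotProduct, sq]

theorem vnorm_mulVec_le {m n : ℕ} (A : Matrix (Fin m) (Fin n) ℝ) (x : Fin n → ℝ) :
    vnorm (A *ᵥ x) ≤ mnorm A * vnorm x := by
  rw [vnorm_eq, vnorm_eq]
  exact (LinearMap.toContinuousLinearMap (Matrix.toEuclideanLin A)).le_opNorm (WithLp.toLp 2 x)

theorem dot_le {n : ℕ} (x y : Fin n → ℝ) : x ⬝ᵥ y ≤ vnorm x * vnorm y := by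
  have h := Finset.sum_mul_sq_le_sq_mul_sq Finset.univ x y
  have h1 := vnorm_sq x
  have h2 := vnorm_sq y
  have hx : vnorm x ^ 2 = ∑ i, x i ^ 2 := by rw [h1]; simp [dotProduct, sq]
  have hy : vnorm y ^ 2 = ∑ i, y i ^ 2 := by rw [h2]; simp [dotProduct, sq]
  rw [← hx, ← hy, ← mul_pow] at h
  exact (le_abs_self _).trans (abs_le_of_sq_le_sq h (mul_nonneg (vnorm_nn x) (vnorm_nn y)))

theorem psd_nn {n : ℕ} {P : Matrix (Fin n) (Fin n) ℝ} (hP : P.PosSemidef) (x : Fin n → ℝ) :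
    0 ≤ x ⬝ᵥ P *ᵥ x := by
  simpa using hP.dotProduct_mulVec_nonneg x

theorem psd_conj {n m : ℕ} {P : Matrix (Fin n) (Fin n) ℝ} (hP : P.PosSemidef)
    (B : Matrix (Fin n) (Fin m) ℝ) : (Bᵀ * P * B).PosSemidef := by
  have := hP.conjTranspose_mul_mul_same B
  rwa [Matrix.conjTranspose_eq_transpose_of_trivial] at this

theorem herm_tr {n : ℕ} {P : Matrix (Fin n) (Fin n) ℝ} (hP : P.IsHermitian) : Pᵀ = P := by
  have : Pᴴ = P := hP
  rwa [Matrix.conjTranspose_eq_transpose_of_trivial] at this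

theorem dot_conj {n m : ℕ} (P : Matrix (Fin n) (Fin n) ℝ) (B : Matrix (Fin n) (Fin m) ℝ)
    (w : Fin m → ℝ) : w ⬝ᵥ (Bᵀ * P * B) *ᵥ w = (B *ᵥ w) ⬝ᵥ P *ᵥ (B *ᵥ w) := by
  rw [← Matrix.mulVec_mulVec, ← Matrix.mulVec_mulVec, Matrix.dotProduct_mulVec,
    Matrix.vecMul_transpose]

theorem pd_inv {n : ℕ} {M : Matrix (Fin n) (Fin n) ℝ} (h : M.PosDef) :
    M * M⁻¹ = 1 ∧ M⁻¹ * M = 1 := by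
  have hu := (Matrix.isUnit_iff_isUnit_det M).1 h.isUnit
  exact ⟨Matrix.mul_nonsing_inv M hu, Matrix.nonsing_inv_mul M hu⟩

theorem woodbury {n d : ℕ} (P : Matrix (Fin n) (Fin n) ℝ) (B : Matrix (Fin n) (Fin d) ℝ)
    (R : Matrix (Fin d) (Fin d) ℝ) (hR : R.PosDef) (hP : P.PosSemidef) :
    (1 + B * R⁻¹ * Bᵀ * P)⁻¹ = 1 - B * (R + Bᵀ * P * B)⁻¹ * (Bᵀ * P) := by
  apply Matrix.inv_eq_left_inv
  have hM : (R + Bᵀ * P * B).PosDef := hR.add_posSemidef (psd_conj hP B)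
  set M := R + Bᵀ * P * B with hMd
  have h1 := (pd_inv hR).1
  have h2 := (pd_inv hM).2
  have key : M⁻¹ * (Bᵀ * P * B) * R⁻¹ = R⁻¹ - M⁻¹ := by
    have : Bᵀ * P * B = M - R := by rw [hMd]; abel
    rw [this, Matrix.mul_sub, h2, Matrix.sub_mul, Matrix.one_mul, Matrix.mul_assoc, h1,
      Matrix.mul_one]
  have e : (1 - B * M⁻¹ * (Bᵀ * P)) * (1 + B * R⁻¹ * Bᵀ * P)
      = 1 + B * R⁻¹ * (Bᵀ * P) - B * M⁻¹ * (Bᵀ * P)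
        - B * (M⁻¹ * (Bᵀ * P * B) * R⁻¹) * (Bᵀ * P) := by
    simp only [Matrix.sub_mul, Matrix.mul_add, Matrix.mul_assoc, Matrix.one_mul, Matrix.mul_one]
    abel
  rw [e, key]
  simp only [Matrix.mul_sub, Matrix.sub_mul]
  abel

theorem riccati_step {n d : ℕ} (A : Matrix (Fin n) (Fin n) ℝ) (B : Matrix (Fin n) (Fin d) ℝ)
    (Q P P' : Matrix (Fin n) (Fin n) ℝ) (R : Matrix (Fin d) (Fin d) ℝ)
    (K L : Matrix (Fin d) (Fin n) ℝ) (hR : R.PosDef) (hP : P.PosSemidef)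
    (hP' : P' = Q + Aᵀ * P * (1 + B * R⁻¹ * Bᵀ * P)⁻¹ * A)
    (hK : K = -((R + Bᵀ * P * B)⁻¹ * (Bᵀ * P * A))) :
    Q + Lᵀ * R * L + (A + B * L)ᵀ * P * (A + B * L)
      = P' + (L - K)ᵀ * (R + Bᵀ * P * B) * (L - K) := by
  have hM : (R + Bᵀ * P * B).PosDef := hR.add_posSemidef (psd_conj hP B)
  rw [woodbury P B R hR hP] at hP'
  have hPt := herm_tr hP.isHermitian
  have hMt := herm_tr hM.isHermitian
  have e0 : Q + Lᵀ * R * L + (A + B * L)ᵀ * P * (A + B * L)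
      = Q + Aᵀ * P * A + (Bᵀ * P * A)ᵀ * L + Lᵀ * (Bᵀ * P * A)
        + Lᵀ * (R + Bᵀ * P * B) * L := by
    simp only [Matrix.transpose_add, Matrix.transpose_mul, Matrix.transpose_transpose, hPt,
      Matrix.add_mul, Matrix.mul_add, Matrix.mul_assoc]
    abel
  have e1 : P' = Q + Aᵀ * P * A + (Bᵀ * P * A)ᵀ * K := by
    rw [hP', hK]
    simp only [Matrix.transpose_mul, Matrix.transpose_transpose, hPt,
      Matrix.mul_sub, Matrix.sub_mul, Matrix.mul_assoc, Matrix.mul_neg, Matrix.mul_one,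
      Matrix.one_mul]
    abel
  rw [e0, e1]
  set M := R + Bᵀ * P * B
  set G := Bᵀ * P * A
  have hMK : M * K = -G := by
    rw [hK, Matrix.mul_neg, ← Matrix.mul_assoc, (pd_inv hM).1, Matrix.one_mul]
  have hKM : Kᵀ * M = -Gᵀ := by
    have := congrArg Matrix.transpose hMK
    rwa [Matrix.transpose_mul, hMt, Matrix.transpose_neg] at this
  have e2 : (L - K)ᵀ * M * (L - K) = Lᵀ * M * L - Lᵀ * (M * K) - (Kᵀ * M) * L + (Kᵀ * M) * K := by
    simp only [Matrix.transpose_sub, Matrix.sub_mul, Matrix.mul_sub, Matrix.mul_assoc]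
    abel
  rw [e2, hMK, hKM]
  simp only [Matrix.mul_neg, Matrix.neg_mul]
  abel

theorem R_ge {d : ℕ} (R : Matrix (Fin d) (Fin d) ℝ) (hR : R.PosDef)
    (h1 : ∀ v : Fin d → ℝ, vnorm v ≤ vnorm (R.mulVec v)) (w : Fin d → ℝ) :
    vnorm w ^ 2 ≤ w ⬝ᵥ R *ᵥ w := by
  set y := R⁻¹ *ᵥ w with hy
  have hRy : R *ᵥ y = w := by
    rw [hy, Matrix.mulVec_mulVec, (pd_inv hR).1, Matrix.one_mulVec]
  have h2 := psd_nn hR.posSemidef (w - y)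
  have hyR : y ⬝ᵥ R *ᵥ w = w ⬝ᵥ w := by
    rw [Matrix.dotProduct_mulVec, ← Matrix.mulVec_transpose, herm_tr hR.isHermitian, hRy]
  rw [Matrix.mulVec_sub, hRy, sub_dotProduct, dotProduct_sub, dotProduct_sub, hyR] at h2
  have h3 := dot_le y w
  have h4 := h1 y
  rw [hRy] at h4
  have h5 := vnorm_sq w
  nlinarith [vnorm_nn w]

set_option maxHeartbeats 2000000 in
theorem gap_bound {n d : ℕ} (A Ah P : Matrix (Fin n) (Fin n) ℝ) (B Bh : Matrix (Fin n) (Fin d) ℝ)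
    (R : Matrix (Fin d) (Fin d) ℝ)
    (K L : Matrix (Fin d) (Fin n) ℝ) (hR : R.PosDef) (hP : P.PosSemidef)
    (h1 : ∀ v : Fin d → ℝ, vnorm v ≤ vnorm (R.mulVec v))
    (hK : K = -((R + Bᵀ * P * B)⁻¹ * (Bᵀ * P * A)))
    (hL : L = -((R + Bhᵀ * P * Bh)⁻¹ * (Bhᵀ * P * Ah)))
    (a b Γ : ℝ) (ha : mnorm (A - Ah) ≤ a) (hb : mnorm (B - Bh) ≤ b)
    (ha0 : 0 < a) (hb0 : 0 < b) (haΓ : a < Γ) (hbΓ : b < Γ)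
    (hA : 1 + mnorm A ≤ Γ) (hB : 1 + mnorm B ≤ Γ) (hPn : 1 + mnorm P ≤ Γ)
    (hKn : 1 + mnorm K ≤ Γ) (x : Fin n → ℝ) :
    x ⬝ᵥ ((L - K)ᵀ * (R + Bᵀ * P * B) * (L - K)) *ᵥ x
      ≤ 50 * Γ ^ 9 * vnorm x ^ 2 * (a + b) ^ 2 := by
  have hM : (R + Bᵀ * P * B).PosDef := hR.add_posSemidef (psd_conj hP B)
  have hMh : (R + Bhᵀ * P * Bh).PosDef := hR.add_posSemidef (psd_conj hP Bh)
  have hΓ : 1 ≤ Γ := by linarith [mnorm_nn A]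
  rw [dot_conj]
  set w := (L - K) *ᵥ x with hw
  set E := Bᵀ * P * (A - Ah) + (B - Bh)ᵀ * P * Ah
    + (Bᵀ * P * (B - Bh) + (B - Bh)ᵀ * P * Bh) * K with hE
  have hMK : (R + Bᵀ * P * B) * K = -(Bᵀ * P * A) := by
    rw [hK, Matrix.mul_neg, ← Matrix.mul_assoc, (pd_inv hM).1, Matrix.one_mul]
  have hML : (R + Bhᵀ * P * Bh) * L = -(Bhᵀ * P * Ah) := by
    rw [hL, Matrix.mul_neg, ← Matrix.mul_assoc, (pd_inv hMh).1, Matrix.one_mul]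
  have hME : (R + Bhᵀ * P * Bh) * (L - K) = E := by
    have e1 : (R + Bhᵀ * P * Bh) * (L - K) = (R + Bhᵀ * P * Bh) * L - (R + Bᵀ * P * B) * K
        + (Bᵀ * P * B - Bhᵀ * P * Bh) * K := by
      simp only [Matrix.mul_sub, Matrix.sub_mul, Matrix.add_mul]
      abel
    rw [e1, hMK, hML, hE]
    simp only [Matrix.mul_sub, Matrix.sub_mul, Matrix.add_mul, Matrix.transpose_sub]
    abel
  have hPn' : mnorm P ≤ Γ := by linarith
  have hAh : mnorm Ah ≤ 2 * Γ := by
    have h := mnorm_add_le A (-(A - Ah))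
    rw [mnorm_neg'] at h
    have e : A + -(A - Ah) = Ah := by abel
    rw [e] at h; linarith
  have hBh : mnorm Bh ≤ 2 * Γ := by
    have h := mnorm_add_le B (-(B - Bh))
    rw [mnorm_neg'] at h
    have e : B + -(B - Bh) = Bh := by abel
    rw [e] at h; linarith
  have tri : ∀ {p q r s : ℕ} (X : Matrix (Fin p) (Fin q) ℝ) (Y : Matrix (Fin q) (Fin r) ℝ)
      (Z : Matrix (Fin r) (Fin s) ℝ) (α β γ : ℝ), mnorm X ≤ α → mnorm Y ≤ β → mnorm Z ≤ γ →
      mnorm (X * Y * Z) ≤ α * β * γ := by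
    intro p q r s X Y Z α β γ hX hY hZ
    have hα := (mnorm_nn X).trans hX
    have hβ := (mnorm_nn Y).trans hY
    calc mnorm (X * Y * Z) ≤ mnorm (X * Y) * mnorm Z := mnorm_mul_le _ _
      _ ≤ (mnorm X * mnorm Y) * mnorm Z := mul_le_mul_of_nonneg_right (mnorm_mul_le _ _) (mnorm_nn _)
      _ ≤ α * β * γ := mul_le_mul (mul_le_mul hX hY (mnorm_nn _) hα) hZ (mnorm_nn _)
          (mul_nonneg hα hβ)
  have hBt : mnorm Bᵀ ≤ Γ := by rw [mnorm_tr]; linarith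
  have hDt : mnorm (B - Bh)ᵀ ≤ b := by rw [mnorm_tr]; exact hb
  have t1 := tri _ _ _ _ _ _ hBt hPn' ha
  have t2 := tri _ _ _ _ _ _ hDt hPn' hAh
  have t3 := tri _ _ _ _ _ _ hBt hPn' hb
  have t4 := tri _ _ _ _ _ _ hDt hPn' hBh
  have t5 : mnorm (Bᵀ * P * (B - Bh) + (B - Bh)ᵀ * P * Bh) ≤ 3 * Γ ^ 2 * b := by
    refine (mnorm_add_le _ _).trans ?_
    linarith
  have t6 : mnorm ((Bᵀ * P * (B - Bh) + (B - Bh)ᵀ * P * Bh) * K) ≤ 3 * Γ ^ 2 * b * Γ :=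
    (mnorm_mul_le _ _).trans (mul_le_mul t5 (by linarith) (mnorm_nn _) (by positivity))
  have t7 : mnorm E ≤ 5 * Γ ^ 3 * (a + b) := by
    have h := mnorm_add_le (Bᵀ * P * (A - Ah) + (B - Bh)ᵀ * P * Ah)
      ((Bᵀ * P * (B - Bh) + (B - Bh)ᵀ * P * Bh) * K)
    have h' := mnorm_add_le (Bᵀ * P * (A - Ah)) ((B - Bh)ᵀ * P * Ah)
    have g : Γ ^ 2 ≤ Γ ^ 3 := pow_le_pow_right₀ hΓ (by norm_num)
    have ga := mul_le_mul_of_nonneg_right g ha0.le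
    have gb := mul_le_mul_of_nonneg_right g hb0.le
    have gc : 0 ≤ Γ ^ 3 * a := by positivity
    linarith
  set e := mnorm E * vnorm x with he
  have he0 : 0 ≤ e := mul_nonneg (mnorm_nn _) (vnorm_nn _)
  have hwM : (R + Bhᵀ * P * Bh) *ᵥ w = E *ᵥ x := by
    rw [hw, Matrix.mulVec_mulVec, hME]
  have hEx : vnorm (E *ᵥ x) ≤ e := vnorm_mulVec_le _ _
  have h2 := dot_le w (E *ᵥ x)
  have h3 := R_ge R hR h1 w
  have h4 : w ⬝ᵥ R *ᵥ w ≤ w ⬝ᵥ E *ᵥ x := by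
    rw [← hwM, Matrix.add_mulVec, dotProduct_add]
    have := psd_nn (psd_conj hP Bh) w
    linarith
  have h5 : w ⬝ᵥ R *ᵥ w ≤ vnorm w * e :=
    h4.trans (h2.trans (mul_le_mul_of_nonneg_left hEx (vnorm_nn _)))
  have h6 : vnorm w ≤ e := by
    by_contra hc
    push Not at hc
    nlinarith
  have h7 : w ⬝ᵥ R *ᵥ w ≤ e ^ 2 := by nlinarith
  have h8 : w ⬝ᵥ (Bᵀ * P * B) *ᵥ w ≤ Γ ^ 3 * e ^ 2 := by
    have i1 := dot_le w ((Bᵀ * P * B) *ᵥ w)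
    have i2 := vnorm_mulVec_le (Bᵀ * P * B) w
    have i3 := tri _ _ _ _ _ _ hBt hPn' (show mnorm B ≤ Γ by linarith)
    have i4 : vnorm ((Bᵀ * P * B) *ᵥ w) ≤ Γ * Γ * Γ * e :=
      i2.trans (mul_le_mul i3 h6 (vnorm_nn _) (by positivity))
    have i5 := mul_le_mul h6 i4 (vnorm_nn _) he0
    linarith
  have h9 : e ≤ 5 * Γ ^ 3 * (a + b) * vnorm x := mul_le_mul_of_nonneg_right t7 (vnorm_nn _)
  have h10 : e ^ 2 ≤ (5 * Γ ^ 3 * (a + b) * vnorm x) ^ 2 := pow_le_pow_left₀ he0 h9 2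
  have h11 : 1 ≤ Γ ^ 3 := one_le_pow₀ hΓ
  rw [Matrix.add_mulVec, dotProduct_add]
  calc _ ≤ e ^ 2 + Γ ^ 3 * e ^ 2 := add_le_add h7 h8
    _ ≤ 2 * Γ ^ 3 * e ^ 2 := by nlinarith [sq_nonneg e]
    _ ≤ 2 * Γ ^ 3 * (5 * Γ ^ 3 * (a + b) * vnorm x) ^ 2 :=
        mul_le_mul_of_nonneg_left h10 (by positivity)
    _ = _ := by ring

/-- suboptimality of the misspecified-model controller under modeling
error only at the first time step: there is an absolute constant `C > 0` such that
`V^CE_0(x_0) - V*_0(x_0) ≤ C d Γ⁹ ‖x_0‖² (ε_A + ε_A² + ε_B + ε_B²)²`. -/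
theorem statement16 :
    ∃ C : ℝ, 0 < C ∧
      ∀ (n d H : ℕ)
        (A Ahat : ℕ → Matrix (Fin n) (Fin n) ℝ)
        (B Bhat : ℕ → Matrix (Fin n) (Fin d) ℝ)
        (Q Qf : Matrix (Fin n) (Fin n) ℝ) (R : Matrix (Fin d) (Fin d) ℝ)
        (Pstar PCE : ℕ → Matrix (Fin n) (Fin n) ℝ)
        (Kstar KCE : ℕ → Matrix (Fin d) (Fin n) ℝ)
        (x : ℕ → Fin n → ℝ) (x0 : Fin n → ℝ) (εA εB δ Γ : ℝ),
        d ≤ n →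
        Q.PosDef → Qf.PosDef → R.PosDef →
        -- `σ̲(R) ≥ 1`
        (∀ v : Fin d → ℝ, vnorm v ≤ vnorm (R.mulVec v)) →
        -- optimal Riccati recursion
        Pstar H = Qf →
        (∀ t, t < H → Pstar t =
          Q + (A t)ᵀ * Pstar (t+1) * (1 + B t * R⁻¹ * (B t)ᵀ * Pstar (t+1))⁻¹ * A t) →
        (∀ t, t < H → Kstar t =
          -((R + (B t)ᵀ * Pstar (t+1) * B t)⁻¹ * ((B t)ᵀ * Pstar (t+1) * A t))) →
        -- misspecified-model Riccati recursion
        PCE H = Qf →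
        (∀ t, t < H → PCE t =
          Q + (Ahat t)ᵀ * PCE (t+1) *
            (1 + Bhat t * R⁻¹ * (Bhat t)ᵀ * PCE (t+1))⁻¹ * Ahat t) →
        (∀ t, t < H → KCE t =
          -((R + (Bhat t)ᵀ * PCE (t+1) * Bhat t)⁻¹ *
            ((Bhat t)ᵀ * PCE (t+1) * Ahat t))) →
        -- the model is exact at every time step except `t = 0`
        (∀ t, 1 ≤ t → t < H → Ahat t = A t) →
        (∀ t, 1 ≤ t → t < H → Bhat t = B t) →
        -- modeling error at the first time step
        mnorm (A 0 - Ahat 0) ≤ εA →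
        mnorm (B 0 - Bhat 0) ≤ εB →
        0 < εA → εA < Γ → 0 < εB → εB < Γ →
        -- `Γ = 1 + max_t {‖A_t‖, ‖B_t‖, ‖P*_t‖, ‖K*_t‖}` (as an upper bound)
        (∀ t, t < H → 1 + mnorm (A t) ≤ Γ) →
        (∀ t, t < H → 1 + mnorm (B t) ≤ Γ) →
        (∀ t, t ≤ H → 1 + mnorm (Pstar t) ≤ Γ) →
        (∀ t, t < H → 1 + mnorm (Kstar t) ≤ Γ) →
        -- stability of the optimal controller
        0 < δ → δ ≤ 1 →
        (∀ t, t < H → mnorm (A t + B t * Kstar t) ≤ 1 - δ) →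
        -- closeness of the controllers
        (∀ t, t < H → mnorm (Kstar t - KCE t) ≤ δ / (2 * mnorm (B t))) →
        -- closed-loop trajectory of the misspecified-model controller on the true system
        x 0 = x0 →
        (∀ t, t < H → x (t+1) = (A t + B t * KCE t).mulVec (x t)) →
        (∑ t ∈ Finset.range H,
            (x t ⬝ᵥ Q.mulVec (x t) +
              (KCE t).mulVec (x t) ⬝ᵥ R.mulVec ((KCE t).mulVec (x t))) +
            x H ⬝ᵥ Qf.mulVec (x H))
          - x0 ⬝ᵥ (Pstar 0).mulVec x0 ≤
        C * d * Γ ^ 9 * vnorm x0 ^ 2 * (εA + εA ^ 2 + εB + εB ^ 2) ^ 2 := by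
  refine ⟨50, by norm_num, ?_⟩
  intro n d H A Ahat B Bhat Q Qf R Pstar PCE Kstar KCE x x0 εA εB δ Γ hdn hQ hQf hR hR1
    hPH hP hK hCH hCP hCK hAe hBe hεA hεB hA0 hAΓ hB0 hBΓ hΓA hΓB hΓP hΓK hδ0 hδ1 hst hcl hx0 hx
  have hΓ0 : 0 < Γ := hA0.trans hAΓ
  have hrhs : 0 ≤ 50 * (d : ℝ) * Γ ^ 9 * vnorm x0 ^ 2 * (εA + εA ^ 2 + εB + εB ^ 2) ^ 2 := by
    positivity
  -- positive semidefiniteness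
  have psd : ∀ k, k ≤ H → (Pstar (H - k)).PosSemidef := by
    intro k
    induction k with
    | zero => intro _; rw [Nat.sub_zero, hPH]; exact hQf.posSemidef
    | succ k ih =>
      intro hk
      have h1 := ih (by omega)
      have e : H - k = H - (k + 1) + 1 := by omega
      rw [e] at h1
      have hlt : H - (k + 1) < H := by omega
      have h2 := riccati_step _ _ Q _ _ R _ (Kstar (H - (k + 1))) hR h1 (hP _ hlt) (hK _ hlt)
      rw [sub_self, Matrix.mul_zero, add_zero] at h2
      rw [← h2]
      exact (hQ.posSemidef.add (psd_conj hR.posSemidef _)).add (psd_conj h1 _)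
  have psd' : ∀ t, t ≤ H → (Pstar t).PosSemidef := by
    intro t ht
    have := psd (H - t) (by omega)
    rwa [Nat.sub_sub_self ht] at this
  have same : ∀ k, k + 1 ≤ H → PCE (H - k) = Pstar (H - k) := by
    intro k
    induction k with
    | zero => intro _; rw [Nat.sub_zero, hPH, hCH]
    | succ k ih =>
      intro hk
      have h1 := ih (by omega)
      have e : H - k = H - (k + 1) + 1 := by omega
      rw [e] at h1
      have hlt : H - (k + 1) < H := by omega
      rw [hP _ hlt, hCP _ hlt, h1, hAe _ (by omega) hlt, hBe _ (by omega) hlt]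
  have same' : ∀ t, 1 ≤ t → t ≤ H → PCE t = Pstar t := by
    intro t h1 ht
    have := same (H - t) (by omega)
    rwa [Nat.sub_sub_self ht] at this
  have sameK : ∀ t, 1 ≤ t → t < H → KCE t = Kstar t := by
    intro t h1 ht
    rw [hK t ht, hCK t ht, hAe t h1 ht, hBe t h1 ht, same' (t + 1) (by omega) (by omega)]
  let gap : ℕ → ℝ := fun t => x t ⬝ᵥ ((KCE t - Kstar t)ᵀ * (R + (B t)ᵀ * Pstar (t+1) * B t) *
    (KCE t - Kstar t)) *ᵥ x t
  have step : ∀ t, t < H → x t ⬝ᵥ Q.mulVec (x t) +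
      (KCE t).mulVec (x t) ⬝ᵥ R.mulVec ((KCE t).mulVec (x t))
      = (x t ⬝ᵥ Pstar t *ᵥ x t - x (t+1) ⬝ᵥ Pstar (t+1) *ᵥ x (t+1)) + gap t := by
    intro t ht
    have h := riccati_step _ _ Q _ _ R _ (KCE t) hR (psd' (t+1) ht) (hP _ ht) (hK _ ht)
    have h' := congrArg (fun M => x t ⬝ᵥ M *ᵥ x t) h
    simp only [Matrix.add_mulVec (_ + _) _ (x t), Matrix.add_mulVec Q _ (x t),
      Matrix.add_mulVec (Pstar t) _ (x t), dotProduct_add] at h'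
    rw [dot_conj, dot_conj (Pstar (t+1)) (A t + B t * KCE t), ← hx t ht] at h'
    simp only [gap]
    linarith
  have hsum : ∑ t ∈ Finset.range H,
            (x t ⬝ᵥ Q.mulVec (x t) +
              (KCE t).mulVec (x t) ⬝ᵥ R.mulVec ((KCE t).mulVec (x t)))
      = (x 0 ⬝ᵥ Pstar 0 *ᵥ x 0 - x H ⬝ᵥ Pstar H *ᵥ x H) + ∑ t ∈ Finset.range H, gap t := by
    rw [Finset.sum_congr rfl fun t ht => step t (Finset.mem_range.1 ht), Finset.sum_add_distrib,
      Finset.sum_range_sub' (fun t => x t ⬝ᵥ Pstar t *ᵥ x t)]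
  rw [hsum, hPH, hx0]
  suffices hg : ∑ t ∈ Finset.range H, gap t ≤
      50 * (d : ℝ) * Γ ^ 9 * vnorm x0 ^ 2 * (εA + εA ^ 2 + εB + εB ^ 2) ^ 2 by linarith
  rcases Nat.eq_zero_or_pos H with hH | hH
  · rw [hH, Finset.sum_range_zero]; exact hrhs
  have hg0 : ∑ t ∈ Finset.range H, gap t = gap 0 := by
    apply Finset.sum_eq_single_of_mem 0 (Finset.mem_range.2 hH)
    intro t ht h0
    simp only [gap]
    rw [sameK t (by omega) (Finset.mem_range.1 ht), sub_self, Matrix.mul_zero, Matrix.zero_mulVec,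
      dotProduct_zero]
  rw [hg0]
  simp only [gap]
  rw [hx0]
  rcases Nat.eq_zero_or_pos d with hd | hd
  · refine le_trans (le_of_eq ?_) hrhs
    subst hd
    rw [dot_conj]
    simp [dotProduct]
  have hL := hCK 0 hH
  rw [same' (0 + 1) (by omega) (by omega)] at hL
  have hb := gap_bound (A 0) (Ahat 0) (Pstar (0+1)) (B 0) (Bhat 0) R (Kstar 0) (KCE 0) hR
    (psd' (0+1) hH) hR1 (hK 0 hH) hL εA εB Γ hεA hεB hA0 hB0 hAΓ hBΓ (hΓA 0 hH) (hΓB 0 hH)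
    (hΓP (0+1) hH) (hΓK 0 hH) x0
  refine hb.trans ?_
  have hd1 : (1 : ℝ) ≤ d := by exact_mod_cast hd
  have hs : (εA + εB) ^ 2 ≤ (εA + εA ^ 2 + εB + εB ^ 2) ^ 2 :=
    pow_le_pow_left₀ (by positivity) (by nlinarith) 2
  have hc : 0 ≤ 50 * Γ ^ 9 * vnorm x0 ^ 2 := by positivity
  calc _ ≤ 50 * Γ ^ 9 * vnorm x0 ^ 2 * (εA + εA ^ 2 + εB + εB ^ 2) ^ 2 :=
        mul_le_mul_of_nonneg_left hs hc
    _ ≤ d * (50 * Γ ^ 9 * vnorm x0 ^ 2 * (εA + εA ^ 2 + εB + εB ^ 2) ^ 2) :=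
        le_mul_of_one_le_left (by positivity) hd1
    _ = _ := by ring
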